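/- (Paper's equation (XDidsBB), the flat-model form of the tractor identity D_A X^A V = (n+2w+2)(n+w)V.) Let f be a smooth function on ℝ^N ∖ {0} homogeneous of weight w ∈ ℝ. Then Σ_{A,B} h^{AB} · (D^{(w+1)}(X_B · f))_A = (n + 2w + 2)(n + w) · f − Q · Δf on ℝ^N ∖ {0}. (Here X_B · f is homogeneous of weight w + 1, so the operator D is taken at weight w + 1.) -/

import Mathlib

open scoped BigOperators

/-- Partial derivative in the `A`-th coordinate direction. -/
noncomputable def pd {N : ℕ} (A : Fin N) (f : (Fin N → ℝ) → ℝ) : (Fin N → ℝ) → ℝ :=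
  fun x => fderiv ℝ f x (Pi.single A 1)

/-- Ambient Laplacian `Δf = ∑_{A,B} h^{AB} ∂_A ∂_B f` w.r.t. the inverse metric `hInv`. -/
noncomputable def lap {N : ℕ} (hInv : Matrix (Fin N) (Fin N) ℝ)
    (f : (Fin N → ℝ) → ℝ) : (Fin N → ℝ) → ℝ :=
  fun x => ∑ A : Fin N, ∑ B : Fin N, hInv A B * pd A (pd B f) x

/-- `X_A(x) = ∑_B h_{AB} x^B`. -/
def Xc {N : ℕ} (h : Matrix (Fin N) (Fin N) ℝ) (A : Fin N) : (Fin N → ℝ) → ℝ :=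
  fun x => ∑ B : Fin N, h A B * x B

/-- `Q(x) = ∑_{A,B} h_{AB} x^A x^B`. -/
def Qfun {N : ℕ} (h : Matrix (Fin N) (Fin N) ℝ) : (Fin N → ℝ) → ℝ :=
  fun x => ∑ A : Fin N, ∑ B : Fin N, h A B * x A * x B

/-- Smooth (C^∞) on `ℝ^N ∖ {0}`. -/
def SmoothOffZero {N : ℕ} (f : (Fin N → ℝ) → ℝ) : Prop :=
  ContDiffOn ℝ (⊤ : ℕ∞) f {x : Fin N → ℝ | x ≠ 0}

/-- Homogeneous of weight `w` on `ℝ^N ∖ {0}`. -/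
def Homog {N : ℕ} (w : ℝ) (f : (Fin N → ℝ) → ℝ) : Prop :=
  ∀ x : Fin N → ℝ, x ≠ 0 → (∑ A : Fin N, x A * pd A f x) = w * f x

/-- Ambient tractor-D operator at weight `w`: `(D^{(w)} f)_A = (n+2w−2)∂_A f − X_A Δf`. -/
noncomputable def Dop {N : ℕ} (n : ℕ) (h hInv : Matrix (Fin N) (Fin N) ℝ) (w : ℝ)
    (f : (Fin N → ℝ) → ℝ) (A : Fin N) : (Fin N → ℝ) → ℝ :=
  fun x => ((n : ℝ) + 2 * w - 2) * pd A f x - Xc h A x * lap hInv f x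

/-- Iterated tractor-D: `seqD … w0 f A 0 = f` and
`seqD … w0 f A (j+1) = (D^{(w0−j)} (seqD … w0 f A j))_{A (j+1)}`. -/
noncomputable def seqD {N : ℕ} (n : ℕ) (h hInv : Matrix (Fin N) (Fin N) ℝ)
    (w0 : ℝ) (f : (Fin N → ℝ) → ℝ) (A : ℕ → Fin N) : ℕ → (Fin N → ℝ) → ℝ
  | 0 => f
  | j + 1 => Dop n h hInv (w0 - (j : ℝ)) (seqD n h hInv w0 f A j) (A (j + 1))

/-- `u` is `O(Q^m)`: `u = Q^m · g` for some smooth `g` on `ℝ^N ∖ {0}`. -/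
def BigOQ {N : ℕ} (h : Matrix (Fin N) (Fin N) ℝ) (m : ℕ) (u : (Fin N → ℝ) → ℝ) : Prop :=
  ∃ g : (Fin N → ℝ) → ℝ, SmoothOffZero g ∧
    ∀ x : Fin N → ℝ, x ≠ 0 → u x = (Qfun h x) ^ m * g x

theorem hasFDerivAt_Xc {N : ℕ} (h : Matrix (Fin N) (Fin N) ℝ) (B : Fin N) (x : Fin N → ℝ) :
    HasFDerivAt (Xc h B)
      (∑ C, h B C • ContinuousLinearMap.proj (R := ℝ) (φ := fun _ : Fin N => ℝ) C) x :=
  HasFDerivAt.fun_sum fun C _ => (hasFDerivAt_apply C x).const_mul (h B C)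

/-- Leibniz rule for `∂_A (X_B f)`. -/
theorem pd_Xc_mul {N : ℕ} (h : Matrix (Fin N) (Fin N) ℝ) (A B : Fin N)
    {f : (Fin N → ℝ) → ℝ} {x : Fin N → ℝ} (hf : DifferentiableAt ℝ f x) :
    pd A (fun y => Xc h B y * f y) x = h B A * f x + Xc h B x * pd A f x := by
  have H := ((hasFDerivAt_Xc h B x).mul hf.hasFDerivAt).fderiv
  change fderiv ℝ (Xc h B * f) x (Pi.single A 1) = _
  rw [H]
  simp [pd, Pi.single_apply]
  ring

theorem pd_congr {N : ℕ} (A : Fin N) {f g : (Fin N → ℝ) → ℝ} {x : Fin N → ℝ}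
    (hfg : f =ᶠ[nhds x] g) : pd A f x = pd A g x := by
  simp only [pd, hfg.fderiv_eq]

theorem SmoothOffZero.contDiffAt {N : ℕ} {f : (Fin N → ℝ) → ℝ} (hf : SmoothOffZero f)
    {x : Fin N → ℝ} (hx : x ≠ 0) : ContDiffAt ℝ (⊤ : ℕ∞) f x :=
  ContDiffOn.contDiffAt hf (isOpen_ne.mem_nhds hx)

theorem SmoothOffZero.differentiableAt {N : ℕ} {f : (Fin N → ℝ) → ℝ} (hf : SmoothOffZero f)
    {x : Fin N → ℝ} (hx : x ≠ 0) : DifferentiableAt ℝ f x :=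
  (hf.contDiffAt hx).differentiableAt (by simp)

theorem SmoothOffZero.pd {N : ℕ} {f : (Fin N → ℝ) → ℝ} (hf : SmoothOffZero f) (A : Fin N) :
    SmoothOffZero (pd A f) := fun _ hx =>
  (((hf.contDiffAt hx).fderiv_right (m := (⊤ : ℕ∞)) (by simp)).clm_apply
    contDiffAt_const).contDiffWithinAt

/-- Second-order Leibniz rule for `∂_C ∂_D (X_B f)`. -/
theorem pd_pd_Xc_mul {N : ℕ} (h : Matrix (Fin N) (Fin N) ℝ) (B C D : Fin N)
    {f : (Fin N → ℝ) → ℝ} (hf : SmoothOffZero f) {x : Fin N → ℝ} (hx : x ≠ 0) :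
    pd C (pd D (fun y => Xc h B y * f y)) x
      = h B D * pd C f x + h B C * pd D f x + Xc h B x * pd C (pd D f) x := by
  have hloc : pd D (fun y => Xc h B y * f y) =ᶠ[nhds x]
      fun y => h B D * f y + Xc h B y * pd D f y := by
    filter_upwards [isOpen_ne.mem_nhds hx] with y hy
    exact pd_Xc_mul h D B (hf.differentiableAt hy)
  have hfx := hf.differentiableAt hx
  have hDf := (hf.pd D).differentiableAt hx
  have hadd : pd C (fun y => h B D * f y + Xc h B y * pd D f y) x
      = h B D * pd C f x + pd C (fun y => Xc h B y * pd D f y) x := by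
    have H := ((hfx.hasFDerivAt.const_mul (h B D)).add
      ((hasFDerivAt_Xc h B x).differentiableAt.mul hDf).hasFDerivAt).fderiv
    exact congrArg (fun L => L (Pi.single C 1)) H
  rw [pd_congr C hloc, hadd, pd_Xc_mul h C B hDf]
  ring

/-- The commutator identity `Δ(X_B f) = 2 ∂_B f + X_B Δf`. -/
theorem lap_Xc_mul {N : ℕ} {h hInv : Matrix (Fin N) (Fin N) ℝ} (hSymm : h.IsSymm)
    (hInvh : h * hInv = 1) (B : Fin N) {f : (Fin N → ℝ) → ℝ} (hf : SmoothOffZero f)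
    {x : Fin N → ℝ} (hx : x ≠ 0) :
    lap hInv (fun y => Xc h B y * f y) x = 2 * pd B f x + Xc h B x * lap hInv f x := by
  have hleft : ∀ C, ∑ D, hInv C D * h B D = (1 : Matrix (Fin N) (Fin N) ℝ) C B := fun C => by
    rw [← mul_eq_one_comm.mp hInvh, Matrix.mul_apply]
    simp only [hSymm.apply]
  have hright : ∀ D, ∑ C, h B C * hInv C D = (1 : Matrix (Fin N) (Fin N) ℝ) B D := fun D => by
    rw [← hInvh, Matrix.mul_apply]
  have h₁ : ∑ C, ∑ D, hInv C D * (h B D * pd C f x) = pd B f x := by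
    simp only [← mul_assoc, ← Finset.sum_mul, hleft, Matrix.one_apply]
    simp
  have h₂ : ∑ C, ∑ D, hInv C D * (h B C * pd D f x) = pd B f x := by
    rw [Finset.sum_comm]
    simp only [← mul_assoc, mul_comm (hInv _ _) (h _ _), ← Finset.sum_mul, hright,
      Matrix.one_apply]
    simp
  simp only [lap, pd_pd_Xc_mul h B _ _ hf hx, mul_add, Finset.sum_add_distrib, h₁, h₂,
    mul_left_comm _ (Xc h B x), ← Finset.mul_sum]
  ring

/-- Raising the index of `X` recovers the position vector. -/
theorem sum_mul_Xc {N : ℕ} {h hInv : Matrix (Fin N) (Fin N) ℝ} (hinv : hInv * h = 1)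
    (A : Fin N) (x : Fin N → ℝ) : ∑ B, hInv A B * Xc h B x = x A := by
  change hInv.mulVec (h.mulVec x) A = x A
  rw [Matrix.mulVec_mulVec, hinv, Matrix.one_mulVec]

theorem sum_mul_Xc_eq_Qfun {N : ℕ} (h : Matrix (Fin N) (Fin N) ℝ) (x : Fin N → ℝ) :
    ∑ B, x B * Xc h B x = Qfun h x := by
  simp only [Xc, Qfun, Finset.mul_sum]
  exact Finset.sum_congr rfl fun _ _ => Finset.sum_congr rfl fun _ _ => by ring

/-- equation (XDidsBB): for `f` homogeneous of weight `w`,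
`∑_{A,B} h^{AB} (D^{(w+1)}(X_B·f))_A = (n+2w+2)(n+w) f − Q Δf` on `ℝ^N ∖ {0}`. -/
theorem Dop_contract_X
    (n : ℕ) (hn : 1 ≤ n)
    (h hInv : Matrix (Fin (n + 2)) (Fin (n + 2)) ℝ)
    (hSymm : ∀ A B, h A B = h B A) (hInvh : h * hInv = 1)
    (w : ℝ) (f : (Fin (n + 2) → ℝ) → ℝ) (hf : SmoothOffZero f) (hhom : Homog w f) :
    ∀ x : Fin (n + 2) → ℝ, x ≠ 0 →
      (∑ A : Fin (n + 2), ∑ B : Fin (n + 2),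
          hInv A B * Dop n h hInv (w + 1) (fun y => Xc h B y * f y) A x)
        = ((n : ℝ) + 2 * w + 2) * ((n : ℝ) + w) * f x - Qfun h x * lap hInv f x := by
  intro x hx
  have hS : h.IsSymm := Matrix.IsSymm.ext fun A B => hSymm B A
  have hinv : hInv * h = 1 := mul_eq_one_comm.mp hInvh
  have hinvT : hInv.transpose * h = 1 := by
    rw [← hS.eq, ← Matrix.transpose_mul, hInvh, Matrix.transpose_one]
  have htr : ∑ A, ∑ B, hInv A B * h B A = (n : ℝ) + 2 := by
    have H : (hInv * h).trace = (n : ℝ) + 2 := by rw [hinv]; simp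
    simpa only [Matrix.trace, Matrix.diag, Matrix.mul_apply] using H
  have hpd : ∑ A, ∑ B, hInv A B * pd A (fun y => Xc h B y * f y) x
      = ((n : ℝ) + 2 + w) * f x := by
    simp only [pd_Xc_mul h _ _ (hf.differentiableAt hx), mul_add, Finset.sum_add_distrib,
      ← mul_assoc, ← Finset.sum_mul, htr, sum_mul_Xc hinv, hhom x hx]
    ring
  have hlap : ∑ A, ∑ B, hInv A B * (Xc h A x * lap hInv (fun y => Xc h B y * f y) x)
      = 2 * w * f x + Qfun h x * lap hInv f x := by
    have hraise : ∀ B, ∑ A, hInv A B * Xc h A x = x B := fun B => sum_mul_Xc hinvT B x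
    rw [Finset.sum_comm]
    simp only [lap_Xc_mul hS hInvh _ hf hx, ← mul_assoc, ← Finset.sum_mul, hraise]
    simp only [mul_add, ← mul_assoc, Finset.sum_add_distrib, ← Finset.sum_mul,
      sum_mul_Xc_eq_Qfun, mul_right_comm _ (2 : ℝ), hhom x hx]
    ring
  simp only [Dop, mul_sub, Finset.sum_sub_distrib, hlap]
  simp only [mul_left_comm (hInv _ _) (_ - 2), ← Finset.mul_sum, hpd]
  ring
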